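/- Under the sector setup (see context), write p = λu + μv with λ, μ > 0. Define f(λ,μ) := (λ+μ)(λ+μ−1)/(4λμ), g(λ,μ) := (1/4)·(λ+μ−1)²·min{1/[μ(1+λ/4+μ)], 1/[λ(1+λ+μ/4)], 1/(λμ)}, and α := max{|[u,v,x]|/|[u,v,p]| : x ∈ C ∩ [u,v,p]} ∈ [0,1]. Then |C|·|C*| ≥ f(λ,μ) + g(λ,μ)·α(1−α). -/

import Mathlib

open MeasureTheory Pointwise Real
open scoped RealInnerProductSpace

/-- Area (two-dimensional Lebesgue measure) of a subset of the plane `ℂ ≅ ℝ²`. -/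
noncomputable def area (K : Set ℂ) : ℝ := (volume K).toReal

/-- The polar body `K* = {x : ⟨x,y⟩ ≤ 1 for all y ∈ K}`. -/
def polarBody (K : Set ℂ) : Set ℂ := {x | ∀ y ∈ K, ⟪x, y⟫ ≤ 1}

/-- A convex body: a compact convex set with nonempty interior. -/
def IsConvexBody (K : Set ℂ) : Prop := Convex ℝ K ∧ IsCompact K ∧ (interior K).Nonempty

/-- The planar cross product (oriented area of the parallelogram spanned by `a` and `b`). -/
def planeCross (a b : ℂ) : ℝ := a.re * b.im - a.im * b.re

/-- The open sector swept counterclockwise from the ray of `a` to the ray of `b`. -/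
def openSector (a b : ℂ) : Set ℂ := {y | 0 < planeCross a y ∧ 0 < planeCross y b}

theorem inner_eq_re_im (a b : ℂ) : ⟪a, b⟫ = a.re * b.re + a.im * b.im := by
  rw [Complex.inner]; simp; ring

theorem isOpen_openSector (a b : ℂ) : IsOpen (openSector a b) := by
  apply IsOpen.inter
  · exact isOpen_lt continuous_const
      (by fun_prop : Continuous fun y : ℂ => a.re * y.im - a.im * y.re)
  · exact isOpen_lt continuous_const
      (by fun_prop : Continuous fun y : ℂ => y.re * b.im - y.im * b.re)

theorem volume_standard_triangle :
    volume {z : ℂ | 0 < z.re ∧ 0 < z.im ∧ z.re + z.im < 1} = ENNReal.ofReal (1 / 2) := by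
  have h1 : {z : ℂ | 0 < z.re ∧ 0 < z.im ∧ z.re + z.im < 1} = Complex.measurableEquivRealProd ⁻¹'
      (regionBetween (fun _ => (0 : ℝ)) (fun x => 1 - x) (Set.Ioc 0 1)) := by
    ext z
    simp only [regionBetween, Set.mem_ofPred_eq, Set.mem_preimage, Set.mem_Ioc, Set.mem_Ioo,
      Complex.measurableEquivRealProd_apply]
    constructor
    · rintro ⟨h1, h2, h3⟩
      exact ⟨⟨h1, by linarith⟩, h2, by linarith⟩
    · rintro ⟨⟨h1, _⟩, h2, h3⟩
      exact ⟨h1, h2, by linarith⟩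
  rw [h1, Complex.volume_preserving_equiv_real_prod.measure_preimage_equiv,
    Measure.volume_eq_prod, volume_regionBetween_eq_integral]
  · congr 1
    rw [← intervalIntegral.integral_of_le zero_le_one]
    simp only [Pi.sub_apply, sub_zero]
    rw [intervalIntegral.integral_sub (by simp) (by simp)]
    simp; norm_num
  · exact (continuousOn_const.integrableOn_compact isCompact_Icc).mono_set Set.Ioc_subset_Icc_self
  · exact ((by fun_prop : Continuous fun x : ℝ => 1 - x).continuousOn.integrableOn_compact
      isCompact_Icc).mono_set Set.Ioc_subset_Icc_self
  · exact measurableSet_Ioc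
  · rintro x ⟨_, hx⟩
    simpa using hx

/-- The real-linear map sending `1` to `a` and `Complex.I` to `b`. -/
noncomputable def basisMap (a b : ℂ) : ℂ →ₗ[ℝ] ℂ :=
  Complex.reLm.smulRight a + Complex.imLm.smulRight b

theorem basisMap_apply (a b z : ℂ) : basisMap a b z = z.re • a + z.im • b := by
  simp [basisMap]

theorem det_basisMap (a b : ℂ) : LinearMap.det (basisMap a b) = planeCross a b := by
  rw [← LinearMap.det_toMatrix Complex.basisOneI, Matrix.det_fin_two]
  simp [LinearMap.toMatrix_apply, basisMap_apply, planeCross]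
  ring

theorem half_cross_le_volume_inter_openSector {P : Set ℂ} (hP : Convex ℝ P) (h0 : 0 ∈ P) {a b : ℂ}
    (ha : a ∈ P) (hb : b ∈ P) :
    ENNReal.ofReal (planeCross a b / 2) ≤ volume (P ∩ openSector a b) := by
  rcases le_or_gt (planeCross a b) 0 with h | h
  · rw [ENNReal.ofReal_of_nonpos (by linarith)]; exact zero_le
  have hsub : basisMap a b '' {z : ℂ | 0 < z.re ∧ 0 < z.im ∧ z.re + z.im < 1} ⊆
      P ∩ openSector a b := by
    rintro _ ⟨z, ⟨h1, h2, h3⟩, rfl⟩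
    rw [basisMap_apply]
    refine ⟨?_, ?_, ?_⟩
    · have := hP.sum_mem (t := Finset.univ) (w := ![z.re, z.im, 1 - z.re - z.im])
        (z := ![a, b, 0]) (by intro i _; fin_cases i <;> simp <;> linarith)
        (by simp [Fin.sum_univ_three])
        (by intro i _; fin_cases i <;> simp [*])
      simpa [Fin.sum_univ_three] using this
    · have : planeCross a (z.re • a + z.im • b) = z.im * planeCross a b := by
        simp [planeCross]; ring
      rw [this]; positivity
    · have : planeCross (z.re • a + z.im • b) b = z.re * planeCross a b := by
        simp [planeCross]; ring
      rw [this]; positivity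
  refine le_trans (le_of_eq ?_) (measure_mono hsub)
  rw [Measure.addHaar_image_linearMap, det_basisMap, volume_standard_triangle,
    ← ENNReal.ofReal_mul (abs_nonneg _), abs_of_pos h]
  congr 1; ring

theorem volume_openSector_add_le (P : Set ℂ) {a b x : ℂ} {r t : ℝ} (hr : 0 ≤ r) (ht : 0 ≤ t)
    (hx : x = r • a + t • b) :
    volume (P ∩ openSector a x) + volume (P ∩ openSector x b) ≤ volume (P ∩ openSector a b) := by
  rw [← measure_inter_add_sdiff (P ∩ openSector a b) (isOpen_openSector a x).measurableSet]
  have e1 : ∀ y, planeCross y x = - r * planeCross a y + t * planeCross y b := by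
    intro y; subst hx; simp [planeCross]; ring
  have e2 : ∀ y, planeCross x y = r * planeCross a y - t * planeCross y b := by
    intro y; subst hx; simp [planeCross]; ring
  refine add_le_add (measure_mono ?_) (measure_mono ?_)
  · rintro y ⟨hy, h1, h2⟩
    refine ⟨⟨hy, h1, ?_⟩, h1, h2⟩
    rw [e1] at h2
    by_contra! h
    nlinarith [mul_nonneg hr h1.le, mul_nonneg ht (neg_nonneg.2 h)]
  · rintro y ⟨hy, h1, h2⟩
    refine ⟨⟨hy, ?_, h2⟩, fun h_mem => ?_⟩
    · rw [e2] at h1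
      by_contra! h
      nlinarith [mul_nonneg hr (neg_nonneg.2 h), mul_nonneg ht h2.le]
    · have h3 := h_mem.2
      rw [e1] at h3
      rw [e2] at h1
      linarith

theorem convexHull_triangle_eq_image (u v x : ℂ) :
    convexHull ℝ {u, v, x} =
      u +ᵥ (basisMap (v - u) (x - u) '' convexHull ℝ {0, 1, Complex.I}) := by
  rw [LinearMap.image_convexHull, ← convexHull_vadd]
  congr 1
  simp [Set.image_insert_eq, basisMap_apply, Set.vadd_set_insert, ]

theorem area_convexHull_triangle (u v x : ℂ) :
    area (convexHull ℝ {u, v, x}) =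
      |planeCross (v - u) (x - u)| * area (convexHull ℝ {0, 1, Complex.I}) := by
  unfold area
  rw [convexHull_triangle_eq_image, measure_vadd, Measure.addHaar_image_linearMap, det_basisMap,
    ENNReal.toReal_mul, ENNReal.toReal_ofReal (abs_nonneg _)]

theorem volume_convexHull_finite_ne_top {s : Set ℂ} (hs : s.Finite) :
    volume (convexHull ℝ s) ≠ ⊤ := (hs.isCompact_convexHull (𝕜 := ℝ)).measure_lt_top.ne

theorem area_standard_triangle_pos : 0 < area (convexHull ℝ ({0, 1, Complex.I} : Set ℂ)) := by
  have h := half_cross_le_volume_inter_openSector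
    (convex_convexHull ℝ ({0, 1, Complex.I} : Set ℂ)) (subset_convexHull ℝ _ (by simp))
    (a := 1) (b := Complex.I) (subset_convexHull ℝ _ (by simp)) (subset_convexHull ℝ _ (by simp))
  have h2 := h.trans (measure_mono Set.inter_subset_left)
  refine ENNReal.toReal_pos ?_ (volume_convexHull_finite_ne_top (by simp))
  refine (lt_of_lt_of_le ?_ h2).ne'
  simp [planeCross]

theorem convex_polarBody (K : Set ℂ) : Convex ℝ (polarBody K) := by
  intro x hx y hy a b ha hb hab z hz
  rw [inner_add_left, inner_smul_left, inner_smul_left]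
  simp only [conj_trivial]
  nlinarith [hx z hz, hy z hz]

theorem zero_mem_polarBody (K : Set ℂ) : 0 ∈ polarBody K := by
  intro y _; simp

theorem cross_mul_cross (a b x y : ℂ) :
    planeCross a b * planeCross x y = ⟪a, x⟫ * ⟪b, y⟫ - ⟪a, y⟫ * ⟪b, x⟫ := by
  simp only [inner_eq_re_im, planeCross]; ring

/-- A maximiser over `K` of the functional equal to one at `u` and `v` lies in the cone of
`u` and `v`. -/
theorem exists_maximiser_mem_cone {K : Set ℂ} (hKc : IsCompact K) {u v us vs ps : ℂ}
    (huK : u ∈ K) (hvK : v ∈ K) (hus : us ∈ polarBody K) (hvs : vs ∈ polarBody K)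
    (husu : ⟪us, u⟫ = 1) (hvsv : ⟪vs, v⟫ = 1) (hpu : ⟪ps, u⟫ = 1) (hpv : ⟪ps, v⟫ = 1)
    (hD : 0 < planeCross u v) :
    ∃ X Y : ℝ, 0 ≤ X ∧ 0 ≤ Y ∧ 1 ≤ X + Y ∧ X • u + Y • v ∈ K ∧
      ∀ y ∈ K, ⟪ps, y⟫ ≤ X + Y := by
  obtain ⟨x, hxK, hx⟩ := hKc.exists_isMaxOn ⟨u, huK⟩
    (f := fun y => ⟪ps, y⟫) (by fun_prop)
  have hmax : ∀ y ∈ K, ⟪ps, y⟫ ≤ ⟪ps, x⟫ := fun y hy => hx hy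
  have h1 : 1 ≤ ⟪ps, x⟫ := hpu ▸ hmax u huK
  rcases h1.eq_or_lt with h | h
  · exact ⟨1, 0, by simp, by simp, by simp, by simpa using huK, fun y hy => by
      have := hmax y hy; linarith⟩
  obtain ⟨X, Y, rfl⟩ : ∃ X Y : ℝ, x = X • u + Y • v := by
    refine ⟨planeCross x v / planeCross u v, planeCross u x / planeCross u v, ?_⟩
    have := hD.ne'
    apply Complex.ext <;> simp <;> field_simp <;> simp [planeCross] <;> ring
  simp only [inner_add_right, inner_smul_right, hpu, hpv, mul_one] at hmax h
  have hc := hus v hvK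
  have hd := hvs u huK
  have h3 := hus _ hxK
  have h4 := hvs _ hxK
  simp only [inner_add_right, inner_smul_right, husu, hvsv, mul_one] at h3 h4
  refine ⟨X, Y, ?_, ?_, h.le, hxK, hmax⟩
  · by_contra! hX; nlinarith
  · by_contra! hY; nlinarith

theorem exists_sector_bound {K : Set ℂ} (hKv : Convex ℝ K) (hKc : IsCompact K) (h0 : 0 ∈ K)
    {u v us vs : ℂ} {c d : ℝ}
    (huK : u ∈ K) (hvK : v ∈ K) (hus : us ∈ polarBody K) (hvs : vs ∈ polarBody K)
    (husu : ⟪us, u⟫ = 1) (hvsv : ⟪vs, v⟫ = 1) (hc : ⟪us, v⟫ = c) (hd : ⟪vs, u⟫ = d)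
    (hD : 0 < planeCross u v) (hcd : c * d < 1) :
    ∃ m : ℝ, 1 ≤ m ∧ m ≤ (2 - c - d) / (1 - c * d) ∧
      ENNReal.ofReal (m * planeCross u v / 2) ≤ volume (K ∩ openSector u v) ∧
      ENNReal.ofReal ((2 - c - d) / (1 - c * d) / m * planeCross us vs / 2) ≤
        volume (polarBody K ∩ openSector us vs) := by
  have hcd' : 0 < 1 - c * d := by linarith
  have hc1 : c ≤ 1 := hc ▸ hus v hvK
  have hd1 : d ≤ 1 := hd ▸ hvs u huK
  set A := (1 - d) / (1 - c * d) with hA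
  set B := (1 - c) / (1 - c * d) with hB
  have hA0 : 0 ≤ A := div_nonneg (by linarith) hcd'.le
  have hB0 : 0 ≤ B := div_nonneg (by linarith) hcd'.le
  have hM : (2 - c - d) / (1 - c * d) = A + B := by rw [hA, hB]; ring
  have hpu : ⟪A • us + B • vs, u⟫ = 1 := by
    simp only [inner_add_left, inner_smul_left, conj_trivial, husu, hd]
    rw [hA, hB, mul_one, div_mul_eq_mul_div, ← add_div, div_eq_one_iff_eq hcd'.ne']
    ring
  have hpv : ⟪A • us + B • vs, v⟫ = 1 := by
    simp only [inner_add_left, inner_smul_left, conj_trivial, hvsv, hc]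
    rw [hA, hB, mul_one, div_mul_eq_mul_div, ← add_div, div_eq_one_iff_eq hcd'.ne']
    ring
  obtain ⟨X, Y, hX, hY, hm, hxK, hmax⟩ :=
    exists_maximiser_mem_cone hKc huK hvK hus hvs husu hvsv hpu hpv hD
  have hm0 : 0 < X + Y := by linarith
  have hw : (A / (X + Y)) • us + (B / (X + Y)) • vs ∈ polarBody K := by
    intro y hy
    have := hmax y hy
    simp only [inner_add_left, inner_smul_left, conj_trivial] at this ⊢
    rw [← sub_nonneg] at this ⊢
    have e : 1 - (A / (X + Y) * ⟪us, y⟫ + B / (X + Y) * ⟪vs, y⟫)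
      = (X + Y - (A * ⟪us, y⟫ + B * ⟪vs, y⟫)) / (X + Y) := by field_simp
    rw [e]; positivity
  have hE : 0 < planeCross us vs := by
    have := cross_mul_cross us vs u v
    rw [husu, hvsv, hc, hd] at this
    by_contra! h; nlinarith
  refine ⟨X + Y, hm, ?_, ?_, ?_⟩
  · have h3 := hus _ hxK
    have h4 := hvs _ hxK
    simp only [inner_add_right, inner_smul_right, husu, hvsv, hc, hd, mul_one] at h3 h4
    rw [le_div_iff₀ hcd']
    nlinarith
  · refine le_trans ?_ (volume_openSector_add_le K hX hY rfl)
    refine le_trans (le_of_eq ?_) (add_le_add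
      (half_cross_le_volume_inter_openSector hKv h0 huK hxK)
      (half_cross_le_volume_inter_openSector hKv h0 hxK hvK))
    have e1 : planeCross u (X • u + Y • v) = Y * planeCross u v := by simp [planeCross]; ring
    have e2 : planeCross (X • u + Y • v) v = X * planeCross u v := by simp [planeCross]; ring
    rw [e1, e2, ← ENNReal.ofReal_add (by positivity) (by positivity)]
    congr 1; ring
  · refine le_trans ?_ (volume_openSector_add_le (polarBody K)
      (div_nonneg hA0 hm0.le) (div_nonneg hB0 hm0.le) rfl)
    refine le_trans (le_of_eq ?_) (add_le_add
      (half_cross_le_volume_inter_openSector (convex_polarBody K) (zero_mem_polarBody K) hus hw)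
      (half_cross_le_volume_inter_openSector (convex_polarBody K) (zero_mem_polarBody K) hw hvs))
    have e1 : ∀ a b : ℝ, planeCross us (a • us + b • vs) = b * planeCross us vs := by
      intro a b; simp [planeCross]; ring
    have e2 : ∀ a b : ℝ, planeCross (a • us + b • vs) vs = a * planeCross us vs := by
      intro a b; simp [planeCross]; ring
    rw [e1, e2, ← ENNReal.ofReal_add (by positivity) (by positivity), hM]
    congr 1; ring

theorem mem_convexHull_quad {a b q y : ℂ} {c d l k α β : ℝ} (hl : 0 < l) (hk : 0 < k)
    (hα : 0 ≤ α) (hβ : 0 ≤ β) (hq : q = l • a + k • b) (hc : l + k * c = 1) (hd : d * l + k = 1)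
    (hy : y = α • a + β • b) (h1 : α + c * β ≤ 1) (h2 : d * α + β ≤ 1) :
    y ∈ convexHull ℝ {0, a, b, q} := by
  have hcv := convex_convexHull ℝ ({0, a, b, q} : Set ℂ)
  have m0 : (0 : ℂ) ∈ convexHull ℝ {0, a, b, q} := subset_convexHull ℝ _ (by simp)
  have ma : a ∈ convexHull ℝ {0, a, b, q} := subset_convexHull ℝ _ (by simp)
  have mb : b ∈ convexHull ℝ {0, a, b, q} := subset_convexHull ℝ _ (by simp)
  have mq : q ∈ convexHull ℝ {0, a, b, q} := subset_convexHull ℝ _ (by simp)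
  have key : ∀ z ∈ convexHull ℝ {0, a, b, q}, ∀ r t : ℝ, 0 ≤ r → 0 ≤ t → r + t ≤ 1 →
      r • z + t • q ∈ convexHull ℝ {0, a, b, q} := by
    intro z hz r t hr ht hrt
    have := hcv.sum_mem (t := Finset.univ) (w := ![r, t, 1 - r - t])
        (z := ![z, q, 0]) (by intro i _; fin_cases i <;> simp <;> linarith)
        (by simp [Fin.sum_univ_three])
        (by intro i _; fin_cases i; exacts [hz, mq, m0])
    simpa [Fin.sum_univ_three] using this
  rcases le_total (β * l) (α * k) with h | h
  · have := key a ma (α - β / k * l) (β / k)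
      (by rw [sub_nonneg, div_mul_eq_mul_div, div_le_iff₀ hk]; exact h)
      (by positivity) (by
        have : c = (1 - l) / k := by field_simp; linarith
        rw [this] at h1
        have e : α - β / k * l + β / k = α + (1 - l) / k * β := by ring
        rw [e]; exact h1)
    convert this using 1
    rw [hy, hq, smul_add, smul_smul, smul_smul, div_mul_cancel₀ _ hk.ne', sub_smul]
    abel
  · have := key b mb (β - α / l * k) (α / l)
      (by rw [sub_nonneg, div_mul_eq_mul_div, div_le_iff₀ hl]; exact h)
      (by positivity) (by
        have : d = (1 - k) / l := by field_simp; linarith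
        rw [this] at h2
        have e : β - α / l * k + α / l = (1 - k) / l * α + β := by ring
        rw [e]; exact h2)
    convert this using 1
    rw [hy, hq, smul_add, smul_smul, smul_smul, div_mul_cancel₀ _ hl.ne', sub_smul]
    abel

theorem exists_nonneg_of_mem_openSector {a b y : ℂ} (hD : 0 < planeCross a b)
    (hy : y ∈ openSector a b) : ∃ α β : ℝ, 0 ≤ α ∧ 0 ≤ β ∧ y = α • a + β • b := by
  obtain ⟨h1, h2⟩ := hy
  refine ⟨planeCross y b / planeCross a b, planeCross a y / planeCross a b, by positivity,
    by positivity, ?_⟩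
  have := hD.ne'
  apply Complex.ext <;> simp <;> field_simp <;> simp [planeCross] <;> ring

/-- The scalar inequality behind the gain term. -/
theorem sector_gain_inequality {l k X Y T S q r G m : ℝ} (hl : 0 < l) (hk : 0 < k)
    (hX : 0 < X) (hY : 0 < Y) (hG0 : 0 ≤ G) (hm : m = X + Y) (hml : m ≤ l + k)
    (hq1 : Y ≤ q) (hq2 : q ≤ Y + T) (hr1 : X ≤ r) (hr2 : r ≤ X + S)
    (hGl : G * (Y + T) ≤ l) (hGk : G * (X + S) ≤ k) (hG1 : G ≤ 1) :
    m * (l + k + (T + S) * G) ≤ (q + r) * (l * (Y + T) / q + k * (X + S) / r) := by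
  have hq : 0 < q := by linarith
  have hr : 0 < r := by linarith
  have hm0 : 0 < m := by linarith
  have bound : ∀ {l q r Y X T : ℝ}, 0 < l → 0 < q → 0 < r → 0 < Y → 0 < X → Y ≤ q → q ≤ Y + T →
      X ≤ r → m = X + Y → G * (Y + T) ≤ l →
      m * G * (Y + T - q) ≤ (q + r) * (l * (Y + T - q) / q) := by
    intro l q r Y X T hl hq hr hY hX h1 h2 h3 hm hG
    have h5 : m * G ≤ (q + r) * l / q := by
      rw [le_div_iff₀ hq]
      calc m * G * q ≤ m * l := by nlinarith [mul_le_mul_of_nonneg_left h2 hG0]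
        _ ≤ (q + r) * l := by nlinarith
    calc m * G * (Y + T - q) ≤ (q + r) * l / q * (Y + T - q) :=
          mul_le_mul_of_nonneg_right h5 (by linarith)
      _ = _ := by ring
  have b1 := bound hl hq hr hY hX hq1 hq2 hr1 hm hGl
  have b2 := bound hk hr hq hX hY hr1 hr2 hq1 (by linarith) hGk
  have e : (q + r) * (l * (Y + T) / q + k * (X + S) / r) = (q + r) * (l + k) +
      (q + r) * (l * (Y + T - q) / q) + (r + q) * (k * (X + S - r) / r) := by
    field_simp; ring
  rw [e]
  have h6 : m * G * (q + r - m) ≤ (l + k) * (q + r - m) :=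
    mul_le_mul_of_nonneg_right (by nlinarith) (by linarith)
  linear_combination b1 + b2 + h6 + m * G * hm

theorem subsector_ratio {l k c X Y m α : ℝ} (hk : 0 < k) (hc : l + k * c = 1)
    (hs : 0 < l + k - 1) (hm : m = X + Y) (hm1 : 1 < m) (hY : 0 < Y)
    (hα : α * (l + k - 1) = m - 1) :
    (2 - (X + c * Y) - 1 / m) / (1 - (X + c * Y) * (1 / m)) * Y =
      Y + α * (k * (1 - X) - (1 - l) * Y) := by
  have hm0 : m ≠ 0 := by linarith
  have hl : l = 1 - k * c := by linarith
  have hden : 1 - (X + c * Y) * (1 / m) = (Y * (1 - c)) / m := by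
    field_simp; rw [hm]; ring
  have hnum : 2 - (X + c * Y) - 1 / m = ((m - 1) * (1 - (X + c * Y)) + Y * (1 - c)) / m := by
    field_simp; rw [hm]; ring
  subst hl
  have hc1 : 0 < 1 - c := by
    by_contra! h
    nlinarith
  have hα' : α * k * (1 - c) = m - 1 := by linarith
  rw [hnum, hden, div_div_div_cancel_right₀ hm0, div_mul_eq_mul_div,
    div_eq_iff (by positivity), ← hα']
  ring

/-- A point of the sector cut out by the two supporting lines satisfies a one-coordinate bound. -/
theorem coordinate_add_gain_le {l k d X Y α T S : ℝ} (hl : 0 < l) (hk : 0 < k)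
    (hs : 0 < l + k - 1) (hd : d * l + k = 1) (hα0 : 0 ≤ α) (hα1 : α ≤ 1)
    (hα : α * (l + k - 1) = X + Y - 1) (h4 : d * X + Y ≤ 1) (hS : 0 ≤ S)
    (hTS : T + S = α * (1 - α) * (l + k - 1)) :
    Y + T ≤ 1 + l / 4 + k := by
  have h5 : l * Y + (1 - k) * X ≤ l := by
    have : 1 - k = d * l := by linarith
    rw [this]; nlinarith
  have hY : Y ≤ 1 - α + α * k := by
    have : (l + k - 1) * (Y - (1 - α + α * k)) ≤ 0 := by
      have hX : X = 1 + α * (l + k - 1) - Y := by linarith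
      rw [hX] at h5
      linarith
    by_contra! h
    nlinarith
  nlinarith [mul_nonneg hl.le (sq_nonneg (α - 1 / 2)), mul_nonneg hk.le (sq_nonneg (1 - α)),
    mul_nonneg hα0 (sub_nonneg.2 hα1)]

theorem le_area_of_ofReal_le_volume {A B H : Set ℂ} {a : ℝ} (hBH : B ⊆ H)
    (hH : volume H ≠ ⊤) (hAB : A ⊆ B) (ha : ENNReal.ofReal a ≤ volume A) : a ≤ area B :=
  (ENNReal.ofReal_le_iff_le_toReal (ne_top_of_le_ne_top hH (measure_mono hBH))).1
    (ha.trans (measure_mono hAB))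

theorem planeCross_sub_sub {u v ps : ℂ} (hpu : ⟪ps, u⟫ = 1) (hpv : ⟪ps, v⟫ = 1) (y : ℂ) :
    planeCross (v - u) (y - u) = (1 - ⟪ps, y⟫) * planeCross u v := by
  simp only [inner_eq_re_im, planeCross, Complex.sub_re, Complex.sub_im] at *
  linear_combination (u.re * y.im - u.im * y.re) * hpv +
    (y.re * v.im - y.im * v.re) * hpu

set_option maxHeartbeats 1600000 in
theorem oriented_sector_bound {K : Set ℂ} (hKv : Convex ℝ K) (hKc : IsCompact K) (h0 : 0 ∈ K)
    {u v us vs p ps : ℂ} (huK : u ∈ K) (hvK : v ∈ K)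
    (hus : us ∈ polarBody K) (hvs : vs ∈ polarBody K)
    (husu : ⟪us, u⟫ = 1) (hvsv : ⟪vs, v⟫ = 1)
    (hps : ⟪ps, u⟫ = 1 ∧ ⟪ps, v⟫ = 1) (hD : 0 < planeCross u v)
    {l k c d : ℝ} (hl : 0 < l) (hk : 0 < k) (hs : 0 < l + k - 1) (hp : p = l • u + k • v)
    (hcv : ⟪us, v⟫ = c) (hdu : ⟪vs, u⟫ = d) (hc : l + k * c = 1) (hd : d * l + k = 1)
    {α : ℝ}
    (hα : α = sSup ((fun x => area (convexHull ℝ {u, v, x}) /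
      area (convexHull ℝ {u, v, p})) ''
        (K ∩ convexHull ℝ {0, u, v, p} ∩ convexHull ℝ {u, v, p}))) :
    (l + k) * (l + k - 1) / (4 * l * k) + (1 / 4) * (l + k - 1) ^ 2 *
      min (min (1 / (k * (1 + l / 4 + k))) (1 / (l * (1 + l + k / 4)))) (1 / (l * k)) *
      (α * (1 - α)) ≤
    area (K ∩ convexHull ℝ {0, u, v, p}) * area (polarBody K ∩ convexHull ℝ {0, us, vs, ps}) := by
  obtain ⟨hpu, hpv⟩ := hps
  have hc1 : c ≤ 1 := hcv ▸ hus v hvK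
  have hd1 : d ≤ 1 := hdu ▸ hvs u huK
  have hc' : c = (1 - l) / k := by field_simp; linarith
  have hd' : d = (1 - k) / l := by field_simp; linarith
  have hcd' : 1 - c * d = (l + k - 1) / (l * k) := by
    rw [hc', hd']; field_simp; ring
  have hcd : 0 < 1 - c * d := by rw [hcd']; positivity
  have hDE : planeCross us vs * planeCross u v = 1 - c * d := by
    rw [cross_mul_cross, husu, hvsv, hcv, hdu, one_mul]
  have hE : 0 < planeCross us vs := by
    by_contra! h; nlinarith
  have hps_eq : ps = k • us + l • vs := by
    have e1 : ⟪k • us + l • vs, u⟫ = 1 := by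
      simp only [inner_add_left, inner_smul_left, conj_trivial, husu, hdu]; linarith
    have e2 : ⟪k • us + l • vs, v⟫ = 1 := by
      simp only [inner_add_left, inner_smul_left, conj_trivial, hvsv, hcv]; linarith
    have hD' := hD.ne'
    simp only [inner_eq_re_im] at hpu hpv e1 e2
    apply Complex.ext
    · apply mul_right_cancel₀ hD'
      simp only [planeCross]
      linear_combination v.im * (hpu - e1) - u.im * (hpv - e2)
    · apply mul_right_cancel₀ hD'
      simp only [planeCross]
      linear_combination u.re * (hpv - e2) - v.re * (hpu - e1)
  have lowerC : ∀ a, ENNReal.ofReal a ≤ volume (K ∩ openSector u v) →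
      a ≤ area (K ∩ convexHull ℝ {0, u, v, p}) := by
    intro a
    refine le_area_of_ofReal_le_volume Set.inter_subset_right
      (volume_convexHull_finite_ne_top (by simp)) ?_
    rintro y ⟨hyK, hy⟩
    obtain ⟨r, t, hr, ht, rfl⟩ := exists_nonneg_of_mem_openSector hD hy
    have h3 := hus _ hyK
    have h4 := hvs _ hyK
    simp only [inner_add_right, inner_smul_right, husu, hvsv, hcv, hdu, mul_one] at h3 h4
    exact ⟨hyK, mem_convexHull_quad hl hk hr ht hp hc hd rfl (by linarith) (by linarith)⟩
  have lowerCs : ∀ a, ENNReal.ofReal a ≤ volume (polarBody K ∩ openSector us vs) →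
      a ≤ area (polarBody K ∩ convexHull ℝ {0, us, vs, ps}) := by
    intro a
    refine le_area_of_ofReal_le_volume Set.inter_subset_right
      (volume_convexHull_finite_ne_top (by simp)) ?_
    rintro y ⟨hyK, hy⟩
    obtain ⟨r, t, hr, ht, rfl⟩ := exists_nonneg_of_mem_openSector hE hy
    have h3 := hyK u huK
    have h4 := hyK v hvK
    simp only [inner_add_left, inner_smul_left, conj_trivial, husu, hvsv, hcv, hdu, mul_one]
      at h3 h4
    exact ⟨hyK, mem_convexHull_quad (c := d) (d := c) hk hl hr ht hps_eq (by linarith)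
      (by linarith) rfl (by linarith) (by linarith)⟩
  obtain ⟨X, Y, hX, hY, hm1, hxK, hmax⟩ :=
    exists_maximiser_mem_cone hKc huK hvK hus hvs husu hvsv hpu hpv hD
  have h3 := hus _ hxK
  have h4 := hvs _ hxK
  simp only [inner_add_right, inner_smul_right, husu, hvsv, hcv, hdu, mul_one] at h3 h4
  have hlX : 0 ≤ l - l * d * X - l * Y := by nlinarith
  have hkX : 0 ≤ k - k * X - k * c * Y := by nlinarith
  have hml : X + Y ≤ l + k := by
    have e1 : l * d = 1 - k := by linarith
    have e2 : k * c = 1 - l := by linarith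
    rw [e1] at hlX; rw [e2] at hkX
    linarith
  have hxtri : X • u + Y • v ∈ convexHull ℝ {u, v, p} := by
    set κ := (X + Y - 1) / (l + k - 1) with hκ
    have hκs : κ * (l + k - 1) = X + Y - 1 := div_mul_cancel₀ _ hs.ne'
    have hκ0 : 0 ≤ κ := div_nonneg (by linarith) hs.le
    have n1 : 0 ≤ X - κ * l := by
      have : 0 ≤ (X - κ * l) * (l + k - 1) := by
        have e : l * d = 1 - k := by linarith
        rw [e] at hlX
        linear_combination hlX + l * hκs
      exact nonneg_of_mul_nonneg_left this hs
    have n2 : 0 ≤ Y - κ * k := by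
      have : 0 ≤ (Y - κ * k) * (l + k - 1) := by
        have e : k * c = 1 - l := by linarith
        rw [e] at hkX
        linear_combination hkX + k * hκs
      exact nonneg_of_mul_nonneg_left this hs
    have := (convex_convexHull ℝ ({u, v, p} : Set ℂ)).sum_mem (t := Finset.univ)
      (w := ![X - κ * l, Y - κ * k, κ]) (z := ![u, v, p])
      (by intro i _; fin_cases i; exacts [n1, n2, hκ0])
      (by simp only [Fin.sum_univ_three, Matrix.cons_val]; linarith)
      (by intro i _; fin_cases i <;> exact subset_convexHull ℝ _ (by simp))
    convert this using 1
    simp only [Fin.sum_univ_three, Matrix.cons_val, hp, sub_smul, smul_add, smul_smul]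
    abel
  have hαeq : α = (X + Y - 1) / (l + k - 1) := by
    rw [hα]
    have hratio : ∀ y ∈ convexHull ℝ {u, v, p}, area (convexHull ℝ {u, v, y}) /
        area (convexHull ℝ {u, v, p}) = (⟪ps, y⟫ - 1) / (l + k - 1) := by
      intro y hy
      have hy1 : 1 ≤ ⟪ps, y⟫ := by
        have hsub : convexHull ℝ {u, v, p} ⊆ {y | 1 ≤ ⟪ps, y⟫} := by
          refine convexHull_min ?_ ?_
          · rintro z (rfl | rfl | rfl)
            · exact hpu.ge
            · exact hpv.ge
            · simp only [Set.mem_ofPred_eq, hp, inner_add_right, inner_smul_right, hpu, hpv]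
              linarith
          · intro a ha b hb r t hr ht hrt
            simp only [Set.mem_ofPred_eq, inner_add_right, inner_smul_right] at *
            nlinarith
        exact hsub hy
      have hpp : ⟪ps, p⟫ = l + k := by
        simp only [hp, inner_add_right, inner_smul_right, hpu, hpv, mul_one]
      rw [area_convexHull_triangle, area_convexHull_triangle u v p,
        planeCross_sub_sub hpu hpv, planeCross_sub_sub hpu hpv, hpp, abs_mul, abs_mul,
        abs_of_nonpos (by linarith), abs_of_nonpos (by linarith : 1 - (l + k) ≤ 0), abs_of_pos hD,
        mul_div_mul_right _ _ area_standard_triangle_pos.ne', mul_div_mul_right _ _ hD.ne']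
      congr 1 <;> ring
    refine IsGreatest.csSup_eq ⟨⟨X • u + Y • v, ⟨⟨hxK, ?_⟩, ?_⟩, ?_⟩, ?_⟩
    · exact mem_convexHull_quad hl hk hX hY hp hc hd rfl (by linarith) (by linarith)
    · exact hxtri
    · dsimp only
      rw [hratio _ hxtri]
      simp only [inner_add_right, inner_smul_right, hpu, hpv, mul_one]
    · rintro _ ⟨y, ⟨⟨hyK, -⟩, hy⟩, rfl⟩
      dsimp only
      rw [hratio y hy]
      have := hmax y hyK
      gcongr
  have hαs : α * (l + k - 1) = X + Y - 1 := by rw [hαeq, div_mul_cancel₀ _ hs.ne']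
  have hα0 : 0 ≤ α := by rw [hαeq]; exact div_nonneg (by linarith) hs.le
  have hα1 : α ≤ 1 := by rw [hαeq, div_le_one hs]; linarith
  clear hα hαeq hxtri
  set G := min (min (1 / (k * (1 + l / 4 + k))) (1 / (l * (1 + l + k / 4)))) (1 / (l * k))
  by_cases hδ : α * (1 - α) = 0
  · rw [hδ, mul_zero, add_zero]
    obtain ⟨m, hm, -, b1, b2⟩ :=
      exists_sector_bound hKv hKc h0 huK hvK hus hvs husu hvsv hcv hdu hD (by linarith)
    have hm0 : 0 < m := by linarith
    have hM : (2 - c - d) / (1 - c * d) = l + k := by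
      rw [hcd', hc', hd', div_eq_iff (by positivity)]; field_simp; ring
    rw [hM] at b2
    refine le_trans (le_of_eq ?_) (mul_le_mul (lowerC _ b1) (lowerCs _ b2) (by positivity)
      ENNReal.toReal_nonneg)
    calc (l + k) * (l + k - 1) / (4 * l * k) = (l + k) * ((l + k - 1) / (l * k)) / 4 := by
          field_simp
      _ = (l + k) * (planeCross us vs * planeCross u v) / 4 := by rw [hDE, hcd']
      _ = _ := by field_simp; norm_num
  have hα0' : 0 < α := hα0.lt_of_ne fun h => hδ (by rw [← h]; ring)
  have hα1' : α < 1 := hα1.lt_of_ne fun h => hδ (by rw [h]; ring)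
  have hm : 1 < X + Y := by
    have := mul_pos hα0' hs
    linarith
  have hY' : 0 < Y := hY.lt_of_ne fun h => by rw [← h] at h3 hm; linarith
  have hX' : 0 < X := hX.lt_of_ne fun h => by rw [← h] at h4 hm; linarith
  obtain ⟨m, hmdef⟩ : ∃ m, m = X + Y := ⟨_, rfl⟩
  rw [← hmdef] at hm hml hαs hmax
  have hm0 : 0 < m := by linarith
  obtain ⟨x, hxdef⟩ : ∃ x, x = X • u + Y • v := ⟨_, rfl⟩
  obtain ⟨w, hwdef⟩ : ∃ w, w = (k / m) • us + (l / m) • vs := ⟨_, rfl⟩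
  have hwps : w = (1 / m) • ps := by
    rw [hwdef, hps_eq, smul_add, smul_smul, smul_smul]; congr 2 <;> ring
  rw [← hxdef] at hxK
  have hwK : w ∈ polarBody K := by
    intro y hy
    rw [hwps, inner_smul_left, conj_trivial, one_div, inv_mul_le_iff₀ hm0, mul_one]
    exact hmax y hy
  have hwu : ⟪w, u⟫ = 1 / m := by rw [hwps, inner_smul_left, conj_trivial, hpu, mul_one]
  have hwv : ⟪w, v⟫ = 1 / m := by rw [hwps, inner_smul_left, conj_trivial, hpv, mul_one]
  have hwx : ⟪w, x⟫ = 1 := by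
    rw [hxdef]
    simp only [inner_add_right, inner_smul_right, hwu, hwv]
    rw [← add_mul, ← hmdef]; field_simp
  have hux : ⟪us, x⟫ = X + c * Y := by
    rw [hxdef]
    simp only [inner_add_right, inner_smul_right, husu, hcv]; ring
  have hvx : ⟪vs, x⟫ = Y + d * X := by
    rw [hxdef]
    simp only [inner_add_right, inner_smul_right, hvsv, hdu]; ring
  have cux : planeCross u x = Y * planeCross u v := by rw [hxdef]; simp [planeCross]; ring
  have cxv : planeCross x v = X * planeCross u v := by rw [hxdef]; simp [planeCross]; ring
  have cuw : planeCross us w = l / m * planeCross us vs := by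
    rw [hwdef]; simp only [planeCross, Complex.add_re, Complex.add_im, Complex.smul_re,
      Complex.smul_im, smul_eq_mul]; ring
  have cwv : planeCross w vs = k / m * planeCross us vs := by
    rw [hwdef]; simp only [planeCross, Complex.add_re, Complex.add_im, Complex.smul_re,
      Complex.smul_im, smul_eq_mul]; ring
  have h1m : 1 / m < 1 := by rw [div_lt_one hm0]; exact hm
  have h1m0 : 0 < 1 / m := by positivity
  obtain ⟨m₁, hm₁, hM₁, b1, b1'⟩ := exists_sector_bound hKv hKc h0 huK hxK hus hwK husu hwx hux hwu
    (by rw [cux]; positivity)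
    ((mul_le_of_le_one_left h1m0.le (by linarith)).trans_lt h1m)
  obtain ⟨m₂, hm₂, hM₂, b2, b2'⟩ := exists_sector_bound hKv hKc h0 hxK hvK hwK hvs hwx hvsv hwv hvx
    (by rw [cxv]; positivity)
    ((mul_le_of_le_one_right h1m0.le (by linarith)).trans_lt h1m)
  have r1 := subsector_ratio hk hc hs hmdef hm hY' hαs
  have r2 := subsector_ratio (l := k) (k := l) (c := d) (X := Y) (Y := X) (α := α) hl (by linarith)
    (by linarith) (by linarith : m = Y + X) hm hX' (by linarith)
  obtain ⟨T, hT⟩ : ∃ T, T = α * (k * (1 - X) - (1 - l) * Y) := ⟨_, rfl⟩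
  obtain ⟨S, hS⟩ : ∃ S, S = α * (l * (1 - Y) - (1 - k) * X) := ⟨_, rfl⟩
  rw [← hT] at r1
  rw [← hS] at r2
  have e2 : (2 - 1 / m - (Y + d * X)) / (1 - 1 / m * (Y + d * X)) =
      (2 - (Y + d * X) - 1 / m) / (1 - (Y + d * X) * (1 / m)) := by
    congr 1 <;> ring
  rw [e2] at hM₂ b2'
  set M₁ := (2 - (X + c * Y) - 1 / m) / (1 - (X + c * Y) * (1 / m))
  set M₂ := (2 - (Y + d * X) - 1 / m) / (1 - (Y + d * X) * (1 / m))
  have hTS : T + S = α * (1 - α) * (l + k - 1) := by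
    rw [hT, hS]
    linear_combination α * hαs + α * hmdef
  have hT0 : 0 ≤ T := by
    have : 0 ≤ (M₁ - 1) * Y := mul_nonneg (by linarith) hY
    linarith
  have hS0 : 0 ≤ S := by
    have : 0 ≤ (M₂ - 1) * X := mul_nonneg (by linarith) hX
    linarith
  have t1 : Y + T ≤ 1 + l / 4 + k := coordinate_add_gain_le (X := X) hl hk hs hd hα0 hα1
    (by linarith) (by linarith) hS0 hTS
  have t2 : X + S ≤ 1 + l + k / 4 := by
    have := coordinate_add_gain_le (l := k) (k := l) (d := c) (X := Y) (Y := X) (T := S) (S := T)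
      hk hl (by linarith) (by linarith) hα0 hα1 (by linarith) (by linarith) hT0 (by linarith)
    linarith
  have hGnn : 0 ≤ l * k * G := by positivity
  have g1 : l * k * G * (1 + l / 4 + k) ≤ l := by
    have : G ≤ 1 / (k * (1 + l / 4 + k)) := (min_le_left _ _).trans (min_le_left _ _)
    rw [le_div_iff₀ (by positivity)] at this
    calc l * k * G * (1 + l / 4 + k) = l * (G * (k * (1 + l / 4 + k))) := by ring
      _ ≤ l := mul_le_of_le_one_right hl.le this
  have g2 : l * k * G * (1 + l + k / 4) ≤ k := by
    have : G ≤ 1 / (l * (1 + l + k / 4)) := (min_le_left _ _).trans (min_le_right _ _)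
    rw [le_div_iff₀ (by positivity)] at this
    calc l * k * G * (1 + l + k / 4) = k * (G * (l * (1 + l + k / 4))) := by ring
      _ ≤ k := mul_le_of_le_one_right hk.le this
  have g3 : l * k * G ≤ 1 := by
    have : G ≤ 1 / (l * k) := min_le_right _ _
    rw [le_div_iff₀ (by positivity)] at this
    linarith
  have gain := sector_gain_inequality (q := m₁ * Y) (r := m₂ * X) hl hk hX' hY' hGnn hmdef hml
    (le_mul_of_one_le_left hY hm₁) (by rw [← r1]; gcongr) (le_mul_of_one_le_left hX hm₂)
    (by rw [← r2]; gcongr)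
    ((mul_le_mul_of_nonneg_left t1 hGnn).trans g1) ((mul_le_mul_of_nonneg_left t2 hGnn).trans g2) g3
  have hM₁0 : 0 < M₁ := by linarith
  have hM₂0 : 0 < M₂ := by linarith
  have p1 := lowerC ((m₁ * Y + m₂ * X) * planeCross u v / 2) <| by
    refine le_trans (le_of_eq ?_) ((add_le_add b1 b2).trans
      (volume_openSector_add_le K hX hY hxdef))
    rw [cux, cxv, ← ENNReal.ofReal_add (by positivity) (by positivity)]
    congr 1; ring
  have p2 := lowerCs ((M₁ / m₁ * l + M₂ / m₂ * k) * planeCross us vs / (2 * m)) <| by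
    refine le_trans (le_of_eq ?_) ((add_le_add b1' b2').trans
      (volume_openSector_add_le (polarBody K) (by positivity) (by positivity) hwdef))
    rw [cuw, cwv, ← ENNReal.ofReal_add (by positivity) (by positivity)]
    congr 1; field_simp
  refine le_trans ?_ (mul_le_mul p1 p2 (by positivity) ENNReal.toReal_nonneg)
  rw [← r1, ← r2, hTS] at gain
  calc (l + k) * (l + k - 1) / (4 * l * k) + 1 / 4 * (l + k - 1) ^ 2 * G * (α * (1 - α))
      = m * (l + k + α * (1 - α) * (l + k - 1) * (l * k * G)) *
          ((l + k - 1) / (l * k)) / (4 * m) := by field_simp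
    _ = m * (l + k + α * (1 - α) * (l + k - 1) * (l * k * G)) *
          (planeCross us vs * planeCross u v) / (4 * m) := by rw [hDE, hcd']
    _ ≤ (m₁ * Y + m₂ * X) * (l * (M₁ * Y) / (m₁ * Y) + k * (M₂ * X) / (m₂ * X)) *
          (planeCross us vs * planeCross u v) / (4 * m) := by gcongr
    _ = _ := by field_simp; ring

theorem planeCross_swap (a b : ℂ) : planeCross a b = -planeCross b a := by
  simp only [planeCross]; ring

theorem planeCross_ne_zero {a b : ℂ} (h : LinearIndependent ℝ ![a, b]) : planeCross a b ≠ 0 := by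
  rw [LinearIndependent.pair_iff] at h
  intro h0
  have h1 := h b.im (-a.im) (by
    apply Complex.ext <;> simp [planeCross] at * <;> linarith)
  have h2 := h b.re (-a.re) (by
    apply Complex.ext <;> simp [planeCross] at * <;> linarith)
  have h3 := h 1 0 (by
    have ha : a = 0 := Complex.ext (by simpa using h2.2) (by simpa using h1.2)
    simp [ha])
  exact one_ne_zero h3.1

/-- Quantitative sector lemma: with `p = λu + μv`, `λ, μ > 0`,
`f(λ,μ) = (λ+μ)(λ+μ−1)/(4λμ)`,
`g(λ,μ) = (1/4)(λ+μ−1)²·min{1/[μ(1+λ/4+μ)], 1/[λ(1+λ+μ/4)], 1/(λμ)}`, and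
`α = max{|[u,v,x]|/|[u,v,p]| : x ∈ C ∩ [u,v,p]}`, one has
`|C|·|C*| ≥ f(λ,μ) + g(λ,μ)·α(1−α)`. -/
theorem sector_lemma_quantitative (K : Set ℂ) (hK : IsConvexBody K)
    (ho : (0 : ℂ) ∈ interior K) (u v us vs p ps : ℂ)
    (huv : LinearIndependent ℝ ![u, v])
    (hu : u ∈ frontier K) (hv : v ∈ frontier K)
    (husvs : LinearIndependent ℝ ![us, vs])
    (hus : us ∈ frontier (polarBody K)) (hvs : vs ∈ frontier (polarBody K))
    (husu : ⟪us, u⟫ = 1) (hvsv : ⟪vs, v⟫ = 1)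
    (hsupp : ∀ y ∈ K, ⟪us, y⟫ ≤ 1 ∧ ⟪vs, y⟫ ≤ 1)
    (hp : ⟪us, p⟫ = 1 ∧ ⟪vs, p⟫ = 1)
    (hpseg : (segment ℝ p 0 ∩ segment ℝ u v).Nonempty)
    (hps : ⟪ps, u⟫ = 1 ∧ ⟪ps, v⟫ = 1)
    (hpsseg : (segment ℝ ps 0 ∩ segment ℝ us vs).Nonempty)
    (C Cs : Set ℂ)
    (hC : C = K ∩ convexHull ℝ {0, u, v, p})
    (hCs : Cs = polarBody K ∩ convexHull ℝ {0, us, vs, ps})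
    (lam mu : ℝ) (hlam : 0 < lam) (hmu : 0 < mu)
    (hpdef : p = lam • u + mu • v)
    (f g α : ℝ)
    (hf : f = (lam + mu) * (lam + mu - 1) / (4 * lam * mu))
    (hg : g = (1 / 4) * (lam + mu - 1) ^ 2 *
      min (min (1 / (mu * (1 + lam / 4 + mu))) (1 / (lam * (1 + lam + mu / 4))))
        (1 / (lam * mu)))
    (hα : α = sSup ((fun x => area (convexHull ℝ {u, v, x}) /
      area (convexHull ℝ {u, v, p})) '' (C ∩ convexHull ℝ {u, v, p}))) :
    f + g * (α * (1 - α)) ≤ area C * area Cs := by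
  have huK : u ∈ K := hK.2.1.isClosed.frontier_subset hu
  have hvK : v ∈ K := hK.2.1.isClosed.frontier_subset hv
  have h0 : (0 : ℂ) ∈ K := interior_subset ho
  have husK : us ∈ polarBody K := fun y hy => (hsupp y hy).1
  have hvsK : vs ∈ polarBody K := fun y hy => (hsupp y hy).2
  have hc : lam + mu * ⟪us, v⟫ = 1 := by
    simpa only [hpdef, inner_add_right, inner_smul_right, husu, mul_one] using hp.1
  have hd : ⟪vs, u⟫ * lam + mu = 1 := by
    simpa only [hpdef, inner_add_right, inner_smul_right, hvsv, mul_one, mul_comm lam] using hp.2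
  have hpp : ⟪ps, p⟫ = lam + mu := by
    simp only [hpdef, inner_add_right, inner_smul_right, hps.1, hps.2, mul_one]
  have hge : 1 ≤ lam + mu := by
    obtain ⟨z, ⟨a, b, ha, hb, hab, rfl⟩, ⟨r, t, hr, ht, hrt, hz⟩⟩ := hpseg
    have h1 := congrArg (fun y => ⟪ps, y⟫) hz
    simp only [inner_add_right, inner_smul_right, hps.1, hps.2, hpp, inner_zero_right, mul_one,
      mul_zero, add_zero, hrt] at h1
    rw [h1]
    exact mul_le_of_le_one_left (by positivity) (by linarith)
  have hDE := cross_mul_cross us vs u v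
  rw [husu, hvsv, one_mul] at hDE
  have hD : planeCross u v ≠ 0 := planeCross_ne_zero huv
  have hE : planeCross us vs ≠ 0 := planeCross_ne_zero husvs
  have hs : 0 < lam + mu - 1 := by
    rcases hge.eq_or_lt with h | h
    · have e1 : ⟪us, v⟫ = 1 := by
        apply mul_left_cancel₀ hmu.ne'
        linarith
      have e2 : ⟪vs, u⟫ = 1 := by
        apply mul_right_cancel₀ hlam.ne'
        linarith
      rw [e1, e2] at hDE
      exact absurd hDE (by simpa using ⟨hE, hD⟩)
    · linarith
  subst hC hCs hf hg
  rcases hD.lt_or_gt with h | h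
  · have h' : 0 < planeCross v u := by rw [planeCross_swap]; linarith
    have eq4 : ∀ a b q : ℂ, ({0, b, a, q} : Set ℂ) = {0, a, b, q} := fun a b q => by
      rw [Set.insert_comm b a]
    have key := oriented_sector_bound (p := p) hK.1 hK.2.1 h0 hvK huK hvsK husK hvsv husu hps.symm h' hmu
      hlam (by linarith) (by rw [hpdef, add_comm]) rfl rfl (by linarith) (by linarith) (α := α)
      (by simpa only [eq4 u v p, Set.insert_comm v u] using hα)
    rw [eq4 u v p, eq4 us vs ps] at key
    refine le_trans (le_of_eq ?_) key
    rw [min_comm (1 / (lam * (1 + mu / 4 + lam))), add_comm mu lam, mul_comm mu lam]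
    ring_nf
  · have key := oriented_sector_bound hK.1 hK.2.1 h0 huK hvK husK hvsK husu hvsv hps h hlam
      hmu hs hpdef rfl rfl hc hd hα
    exact key
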